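/- arXiv:2103.06936 — 3 statements merged into one kernel-verified Lean document; each statement's English description precedes it below -/
import Mathlib

section
/- Let X be a measurable space with probability measure P, let h̄ : X → Bool be a measurable ground-truth classifier, and let ĥ_1, …, ĥ_n : X → Bool be measurable classifiers with mixing weights p_1, …, p_n ≥ 0 summing to 1. Let H be a class of measurable classifiers X → Bool that contains every ĥ_k. Define the disagreement Δ(f,g) = P({x : f(x) ≠ g(x)}), the component errors e(ĥ_k) = Δ(ĥ_k, h̄), and the mixture error e_p(h) = Σ_{k=1}^n p_k · Δ(h, ĥ_k). Then the optimal attacker error e_{p,H} = inf_{h ∈ H} e_p(h) satisfies (1/2) · min_{k} Σ_{r ≠ k} p_r · Δ(ĥ_k, ĥ_r) ≤ e_{p,H} ≤ 2 · max_{k} e(ĥ_k). -/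
open MeasureTheory

/-- The disagreement probability of two functions satisfies the triangle inequality. -/
theorem measureReal_ne_triangle {X Y : Type*} [MeasurableSpace X] (P : Measure X)
    [IsFiniteMeasure P] (f g h : X → Y) :
    P.real {x | f x ≠ h x} ≤ P.real {x | f x ≠ g x} + P.real {x | g x ≠ h x} := by
  refine (measureReal_mono fun x hx => ?_).trans (measureReal_union_le _ _)
  by_contra hc
  simp only [Set.mem_union, Set.mem_ofPred_eq, not_or, not_not] at hc
  exact hx (hc.1.trans hc.2)

theorem measureReal_ne_comm {X Y : Type*} [MeasurableSpace X] (P : Measure X) (f g : X → Y) :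
    P.real {x | f x ≠ g x} = P.real {x | g x ≠ f x} := by
  simp only [ne_comm]

/-- Theorem 1 of the paper (error bounds for reverse-engineering a stochastic HMD):
the optimal attacker error `inf_{h ∈ H} e_p(h)` is bounded below by half the best
component's weighted disagreement with the other components, and above by twice the
maximal component error relative to the ground truth. -/
theorem stochasticHMD_error_bounds
    {X : Type*} [MeasurableSpace X] (P : Measure X) [IsProbabilityMeasure P]
    {n : ℕ} (hn : 0 < n)
    (hbar : X → Bool) (hbar_meas : Measurable hbar)
    (hhat : Fin n → X → Bool) (hhat_meas : ∀ k, Measurable (hhat k))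
    (p : Fin n → ℝ) (hp : ∀ k, 0 ≤ p k) (hpsum : ∑ k, p k = 1)
    (H : Set (X → Bool)) (H_meas : ∀ h ∈ H, Measurable h)
    (hH : ∀ k, hhat k ∈ H) :
    (1 / 2) * (⨅ k : Fin n, ∑ r ∈ Finset.univ.erase k,
        p r * (P {x | hhat k x ≠ hhat r x}).toReal)
      ≤ (⨅ h : H, ∑ k, p k * (P {x | h.1 x ≠ hhat k x}).toReal) ∧
    (⨅ h : H, ∑ k, p k * (P {x | h.1 x ≠ hhat k x}).toReal)
      ≤ 2 * ⨆ k : Fin n, (P {x | hhat k x ≠ hbar x}).toReal := by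
  simp only [← measureReal_def]
  have : Nonempty (Fin n) := ⟨⟨0, hn⟩⟩
  have : Nonempty H := ⟨⟨hhat ⟨0, hn⟩, hH _⟩⟩
  have const_sum (c : ℝ) : ∑ k, p k * c = c := by rw [← Finset.sum_mul, hpsum, one_mul]
  constructor
  · refine le_ciInf fun h => ?_
    obtain ⟨k, hk⟩ := Finite.exists_min fun k => P.real {x | h.1 x ≠ hhat k x}
    have min_le : P.real {x | h.1 x ≠ hhat k x} ≤ ∑ r, p r * P.real {x | h.1 x ≠ hhat r x} := by
      rw [← const_sum (P.real {x | h.1 x ≠ hhat k x})]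
      exact Finset.sum_le_sum fun r _ => mul_le_mul_of_nonneg_left (hk r) (hp r)
    have erase_le : ∑ r ∈ Finset.univ.erase k, p r * P.real {x | hhat k x ≠ hhat r x} ≤
        ∑ r, p r * P.real {x | hhat k x ≠ hhat r x} :=
      Finset.sum_le_sum_of_subset_of_nonneg (Finset.erase_subset _ _)
        fun r _ _ => mul_nonneg (hp r) measureReal_nonneg
    have sum_le : ∑ r, p r * P.real {x | hhat k x ≠ hhat r x} ≤
        ∑ r, p r * (P.real {x | h.1 x ≠ hhat k x} + P.real {x | h.1 x ≠ hhat r x}) := by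
      refine Finset.sum_le_sum fun r _ => mul_le_mul_of_nonneg_left ?_ (hp r)
      rw [measureReal_ne_comm P h.1 (hhat k)]
      exact measureReal_ne_triangle P _ _ _
    simp only [mul_add, Finset.sum_add_distrib, const_sum] at sum_le
    have iInf_le := ciInf_le (Set.finite_range fun k : Fin n =>
      ∑ r ∈ Finset.univ.erase k, p r * P.real {x | hhat k x ≠ hhat r x}).bddBelow k
    linarith
  · have le_sup := le_ciSup (Set.finite_range fun k : Fin n =>
      P.real {x | hhat k x ≠ hbar x}).bddAbove
    have bdd : BddBelow (Set.range fun h : H => ∑ k, p k * P.real {x | h.1 x ≠ hhat k x}) := by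
      refine ⟨0, ?_⟩
      rintro _ ⟨h, rfl⟩
      exact Finset.sum_nonneg fun k _ => mul_nonneg (hp k) measureReal_nonneg
    refine (ciInf_le bdd ⟨hhat ⟨0, hn⟩, hH _⟩).trans ?_
    rw [← const_sum (2 * _)]
    refine Finset.sum_le_sum fun k _ => mul_le_mul_of_nonneg_left ?_ (hp k)
    have triangle := measureReal_ne_triangle P (hhat ⟨0, hn⟩) hbar (hhat k)
    rw [measureReal_ne_comm P hbar (hhat k)] at triangle
    linarith [le_sup ⟨0, hn⟩, le_sup k]
end

section
/- Let X be a measurable space with probability measure P, and let ĥ_1, …, ĥ_n : X → Bool be measurable classifiers with mixing weights p_1, …, p_n ≥ 0 summing to 1. Define Δ(f,g) = P({x : f(x) ≠ g(x)}) and the mixture error e_p(h) = Σ_{k=1}^n p_k · Δ(h, ĥ_k). For every measurable classifier h : X → Bool, e_p(h) ≥ (1/2) · min_{k} Σ_{r ≠ k} p_r · Δ(ĥ_k, ĥ_r). -/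
open MeasureTheory

/-- Triangle inequality for the disagreement pseudometric `Δ(f, g) = P {x | f x ≠ g x}`. -/
theorem measure_ne_toReal_triangle {X Y : Type*} [MeasurableSpace X] (P : Measure X)
    [IsFiniteMeasure P] (f g h : X → Y) :
    (P {x | f x ≠ g x}).toReal ≤ (P {x | h x ≠ f x}).toReal + (P {x | h x ≠ g x}).toReal := by
  have hsub : {x | f x ≠ g x} ⊆ {x | h x ≠ f x} ∪ {x | h x ≠ g x} := by
    intro x hx
    by_contra hcon
    simp only [Set.mem_union, Set.mem_ofPred_eq, not_or, not_not] at hcon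
    exact hx (hcon.1.symm.trans hcon.2)
  exact (measureReal_mono hsub).trans (measureReal_union_le _ _)

/-- Lower-bound half of Theorem 1: every attacker hypothesis `h` has mixture error
`e_p(h)` at least half the best component's weighted disagreement with the others. -/
theorem stochasticHMD_lower_bound
    {X : Type*} [MeasurableSpace X] (P : Measure X) [IsProbabilityMeasure P]
    {n : ℕ} (hn : 0 < n)
    (hhat : Fin n → X → Bool) (hhat_meas : ∀ k, Measurable (hhat k))
    (p : Fin n → ℝ) (hp : ∀ k, 0 ≤ p k) (hpsum : ∑ k, p k = 1)
    (h : X → Bool) (h_meas : Measurable h) :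
    (1 / 2) * (⨅ k : Fin n, ∑ r ∈ Finset.univ.erase k,
        p r * (P {x | hhat k x ≠ hhat r x}).toReal)
      ≤ ∑ k, p k * (P {x | h x ≠ hhat k x}).toReal := by
  have : Nonempty (Fin n) := ⟨⟨0, hn⟩⟩
  let d : Fin n → ℝ := fun k => (P {x | h x ≠ hhat k x}).toReal
  obtain ⟨k, hk⟩ := Finite.exists_min d
  have hmin : d k ≤ ∑ r, p r * d r := calc
    d k = ∑ r, p r * d k := by rw [← Finset.sum_mul, hpsum, one_mul]
    _ ≤ ∑ r, p r * d r :=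
      Finset.sum_le_sum fun r _ => mul_le_mul_of_nonneg_left (hk r) (hp r)
  have hinf : (⨅ k : Fin n, ∑ r ∈ Finset.univ.erase k,
      p r * (P {x | hhat k x ≠ hhat r x}).toReal) ≤ d k + ∑ r, p r * d r := calc
    _ ≤ ∑ r ∈ Finset.univ.erase k, p r * (P {x | hhat k x ≠ hhat r x}).toReal :=
      ciInf_le (Set.finite_range _).bddBelow k
    _ ≤ ∑ r, p r * (P {x | hhat k x ≠ hhat r x}).toReal :=
      Finset.sum_le_sum_of_subset_of_nonneg (Finset.erase_subset _ _)
        fun r _ _ => mul_nonneg (hp r) ENNReal.toReal_nonneg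
    _ ≤ ∑ r, p r * (d k + d r) :=
      Finset.sum_le_sum fun r _ =>
        mul_le_mul_of_nonneg_left (measure_ne_toReal_triangle P _ _ h) (hp r)
    _ = d k + ∑ r, p r * d r := by
      simp only [mul_add, Finset.sum_add_distrib, ← Finset.sum_mul, hpsum, one_mul]
  change _ ≤ ∑ r, p r * d r
  linarith
end

section
/- Let X be a measurable space with probability measure P, let h̄ : X → Bool be a measurable ground-truth classifier, let ĥ_1, …, ĥ_n : X → Bool be measurable classifiers with mixing weights p_1, …, p_n ≥ 0 summing to 1, and let H be a class of measurable classifiers X → Bool containing every ĥ_k. Define Δ(f,g) = P({x : f(x) ≠ g(x)}), e(ĥ_k) = Δ(ĥ_k, h̄), and e_p(h) = Σ_{k=1}^n p_k · Δ(h, ĥ_k). Then inf_{h ∈ H} e_p(h) ≤ 2 · max_{k} e(ĥ_k). -/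
open MeasureTheory

/-- Upper-bound half of Theorem 1: the optimal attacker error `inf_{h ∈ H} e_p(h)` is
at most twice the maximal component error relative to the ground truth. -/
theorem stochasticHMD_upper_bound
    {X : Type*} [MeasurableSpace X] (P : Measure X) [IsProbabilityMeasure P]
    {n : ℕ} (hn : 0 < n)
    (hbar : X → Bool) (hbar_meas : Measurable hbar)
    (hhat : Fin n → X → Bool) (hhat_meas : ∀ k, Measurable (hhat k))
    (p : Fin n → ℝ) (hp : ∀ k, 0 ≤ p k) (hpsum : ∑ k, p k = 1)
    (H : Set (X → Bool)) (H_meas : ∀ h ∈ H, Measurable h)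
    (hH : ∀ k, hhat k ∈ H) :
    (⨅ h : H, ∑ k, p k * (P {x | h.1 x ≠ hhat k x}).toReal)
      ≤ 2 * ⨆ k : Fin n, (P {x | hhat k x ≠ hbar x}).toReal := by
  have triangle (f g : X → Bool) : (P {x | f x ≠ g x}).toReal ≤
      (P {x | f x ≠ hbar x}).toReal + (P {x | g x ≠ hbar x}).toReal := by
    have hsub : {x | f x ≠ g x} ⊆ {x | f x ≠ hbar x} ∪ {x | g x ≠ hbar x} := by
      intro x hx
      by_contra hc
      simp only [Set.mem_union, Set.mem_ofPred_eq, not_or, not_not] at hc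
      exact hx (hc.1.trans hc.2.symm)
    exact (measureReal_mono (μ := P) hsub).trans (measureReal_union_le _ _)
  set M := ⨆ k : Fin n, (P {x | hhat k x ≠ hbar x}).toReal
  have le_M (k : Fin n) : (P {x | hhat k x ≠ hbar x}).toReal ≤ M :=
    le_ciSup (f := fun k : Fin n => (P {x | hhat k x ≠ hbar x}).toReal)
      (Set.finite_range _).bddAbove k
  have bdd : BddBelow (Set.range fun h : H =>
      ∑ k, p k * (P {x | h.1 x ≠ hhat k x}).toReal) := by
    refine ⟨0, ?_⟩
    rintro _ ⟨h, rfl⟩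
    exact Finset.sum_nonneg fun k _ => mul_nonneg (hp k) ENNReal.toReal_nonneg
  let i : Fin n := ⟨0, hn⟩
  calc (⨅ h : H, ∑ k, p k * (P {x | h.1 x ≠ hhat k x}).toReal)
      ≤ ∑ k, p k * (P {x | hhat i x ≠ hhat k x}).toReal := ciInf_le bdd ⟨hhat i, hH i⟩
    _ ≤ ∑ k, p k * (2 * M) := by
        refine Finset.sum_le_sum fun k _ => mul_le_mul_of_nonneg_left ?_ (hp k)
        linarith [triangle (hhat i) (hhat k), le_M i, le_M k]
    _ = 2 * M := by rw [← Finset.sum_mul, hpsum, one_mul]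
end
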